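/- arXiv:2310.16434 — 2 statements merged into one kernel-verified Lean document; each statement's English description precedes it below -/
import Mathlib

section
/- Let N ≥ 1 and let Q be an N×N matrix with nonnegative real entries satisfying Q·𝟙 = Qᵀ·𝟙 = δ·𝟙 for some real δ ≥ 1. Then for every integer p ≥ 1 and all indices x, y ∈ [N], one has Σ_{k=1}^{p} Σ_{(λ₁,…,λ_k) ∈ ℤ_{≥0}^k : λ₁+⋯+λ_k = p} ∏_{t=1}^{k} (Q^{λ_t})_{x,y} ≤ (4δ)^p. -/
open Finset in
theorem card_antidiagonalTuple (k n : ℕ) :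
    (Nat.antidiagonalTuple k n).card = (k + n - 1).choose n := by
  rw [← piAntidiag_univ_fin_eq_antidiagonalTuple]
  have h : (finsuppAntidiag (univ : Finset (Fin k)) n).card =
      (piAntidiag (univ : Finset (Fin k)) n).card := by
    simp [finsuppAntidiag]
  simp [← h, card_finsuppAntidiag_nat_eq_choose]

theorem sum_card_antidiagonalTuple_le (p : ℕ) :
    ∑ k ∈ Finset.Icc 1 p, (Finset.Nat.antidiagonalTuple k p).card ≤ 4 ^ p := by
  rcases p with _ | n
  · simp
  calc ∑ k ∈ Finset.Icc 1 (n + 1), (Finset.Nat.antidiagonalTuple k (n + 1)).card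
      = ∑ j ∈ Finset.range (n + 1), (j + (n + 1)).choose (n + 1) := by
        rw [← Finset.Ico_add_one_right_eq_Icc, Finset.sum_Ico_eq_sum_range]
        refine Finset.sum_congr (by simp) fun j _ => ?_
        rw [card_antidiagonalTuple]
        congr 1
        omega
    _ = (n + (n + 1) + 1).choose (n + 1 + 1) := Nat.sum_range_add_choose n (n + 1)
    _ ≤ 2 ^ (n + (n + 1) + 1) := Nat.choose_le_two_pow _ _
    _ = 4 ^ (n + 1) := by
        rw [show n + (n + 1) + 1 = 2 * (n + 1) by ring, pow_mul]
        norm_num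

namespace Matrix

variable {n : Type*} [Fintype n] [DecidableEq n]

theorem sum_pow_apply_eq_pow {R : Type*} [Semiring R] {Q : Matrix n n R} {δ : R}
    (hrow : ∀ i, ∑ j, Q i j = δ) (m : ℕ) (i : n) : ∑ j, (Q ^ m) i j = δ ^ m := by
  induction m with
  | zero => simp [one_apply]
  | succ m ih =>
    simp_rw [pow_succ, mul_apply]
    rw [Finset.sum_comm]
    simp_rw [← Finset.mul_sum, hrow, ← Finset.sum_mul, ih]

theorem pow_apply_le_pow {Q : Matrix n n ℝ} {δ : ℝ} (hQ : ∀ i j, 0 ≤ Q i j)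
    (hrow : ∀ i, ∑ j, Q i j = δ) (m : ℕ) (i j : n) : (Q ^ m) i j ≤ δ ^ m := by
  rw [← sum_pow_apply_eq_pow hrow m i]
  exact Finset.single_le_sum (f := fun j => (Q ^ m) i j)
    (fun k _ => pow_apply_nonneg hQ m i k) (Finset.mem_univ j)

end Matrix

/-- Let `Q` be an `N×N` matrix with nonnegative real entries satisfying
`Q·𝟙 = Qᵀ·𝟙 = δ·𝟙` for some real `δ ≥ 1`. Then for every integer `p ≥ 1` and all indices
`x, y`, one has
`Σ_{k=1}^{p} Σ_{(λ₁,…,λ_k) : λ₁+⋯+λ_k = p} ∏_{t=1}^{k} (Q^{λ_t})_{x,y} ≤ (4δ)^p`. -/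
theorem stmt0 (N : ℕ) (hN : 1 ≤ N) (Q : Matrix (Fin N) (Fin N) ℝ) (δ : ℝ) (hδ : 1 ≤ δ)
    (hQ : ∀ i j, 0 ≤ Q i j)
    (hrow : ∀ i, ∑ j, Q i j = δ) (hcol : ∀ j, ∑ i, Q i j = δ)
    (p : ℕ) (hp : 1 ≤ p) (x y : Fin N) :
    ∑ k ∈ Finset.Icc 1 p, ∑ lam ∈ Finset.Nat.antidiagonalTuple k p,
        ∏ t, (Q ^ lam t) x y ≤ (4 * δ) ^ p := by
  have hprod : ∀ k, ∀ lam ∈ Finset.Nat.antidiagonalTuple k p,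
      ∏ t, (Q ^ lam t) x y ≤ δ ^ p := fun k lam hlam => by
    rw [← Finset.Nat.mem_antidiagonalTuple.mp hlam, ← Finset.prod_pow_eq_pow_sum]
    exact Finset.prod_le_prod (fun t _ => Matrix.pow_apply_nonneg hQ _ x y)
      fun t _ => Matrix.pow_apply_le_pow hQ hrow _ x y
  calc ∑ k ∈ Finset.Icc 1 p, ∑ lam ∈ Finset.Nat.antidiagonalTuple k p, ∏ t, (Q ^ lam t) x y
      ≤ ∑ k ∈ Finset.Icc 1 p, ((Finset.Nat.antidiagonalTuple k p).card : ℝ) * δ ^ p :=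
        Finset.sum_le_sum fun k _ => by
          simpa only [nsmul_eq_mul] using Finset.sum_le_card_nsmul _ _ _ (hprod k)
    _ = ((∑ k ∈ Finset.Icc 1 p, (Finset.Nat.antidiagonalTuple k p).card : ℕ) : ℝ) * δ ^ p := by
        rw [Nat.cast_sum, Finset.sum_mul]
    _ ≤ 4 ^ p * δ ^ p := by
        gcongr
        exact_mod_cast sum_card_antidiagonalTuple_le p
    _ = (4 * δ) ^ p := (mul_pow _ _ _).symm
end

section
/- Let N ≥ 2 and let Q be an N×N real symmetric matrix with nonnegative entries satisfying Q·𝟙 = 𝟙 (e.g. Q = A/d for the adjacency matrix A of a d-regular graph on N vertices). Set ρ := ‖Q − (1/N)·𝟙⊗𝟙‖ and d := ‖Q‖₀→₁, and assume d ≥ 2, ρ < 1 and ρ ≥ d^{−6}. Then for every integer p ≥ 1 and all x, y ∈ [N], one has Σ_{k=1}^{p} Σ_{(λ₁,…,λ_k) ∈ ℤ_{≥0}^k : λ₁+⋯+λ_k = p and λ_t ≤ ln(N)/(6 ln d) for all t} ∏_{t=1}^{k} (Q^{λ_t})_{x,y} ≤ (8ρ)^p. -/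
open scoped Classical

/-- The `N×N` all-ones matrix `𝟙⊗𝟙`. -/
def onesMat (N : ℕ) : Matrix (Fin N) (Fin N) ℝ := Matrix.of fun _ _ => 1

/-- Euclidean norm of a vector of `ℝ^N`. -/
noncomputable def vecNorm {N : ℕ} (v : Fin N → ℝ) : ℝ := Real.sqrt (∑ i, (v i) ^ 2)

/-- The `ℓ² → ℓ²` operator norm of a matrix, as the supremum of `‖A v‖` over the
closed Euclidean unit ball. -/
noncomputable def opNorm {N : ℕ} (A : Matrix (Fin N) (Fin N) ℝ) : ℝ :=
  sSup {c | ∃ v : Fin N → ℝ, vecNorm v ≤ 1 ∧ c = vecNorm (A.mulVec v)}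

/-- The sparsity parameter `‖B‖₀→₁ = max_x #{y : B_{xy} ≠ 0}`. -/
noncomputable def zeroOneNorm {N : ℕ} (B : Matrix (Fin N) (Fin N) ℝ) : ℕ :=
  Finset.univ.sup fun x => (Finset.univ.filter fun y => B x y ≠ 0).card

theorem vecNorm_eq_norm {N : ℕ} (v : Fin N → ℝ) : vecNorm v = ‖WithLp.toLp 2 v‖ := by
  simp [vecNorm, EuclideanSpace.norm_eq]

theorem vecNorm_smul {N : ℕ} (c : ℝ) (v : Fin N → ℝ) : vecNorm (c • v) = |c| * vecNorm v := by
  simp [vecNorm_eq_norm, norm_smul]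

theorem vecNorm_nonneg {N : ℕ} (v : Fin N → ℝ) : 0 ≤ vecNorm v := Real.sqrt_nonneg _

theorem abs_apply_le_vecNorm {N : ℕ} (v : Fin N → ℝ) (i : Fin N) : |v i| ≤ vecNorm v := by
  rw [vecNorm_eq_norm]
  exact PiLp.norm_apply_le (WithLp.toLp 2 v) i

theorem bddAbove_opNorm {N : ℕ} (A : Matrix (Fin N) (Fin N) ℝ) :
    BddAbove {c | ∃ v : Fin N → ℝ, vecNorm v ≤ 1 ∧ c = vecNorm (A.mulVec v)} := by
  refine ⟨‖Matrix.toEuclideanCLM (𝕜 := ℝ) A‖, ?_⟩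
  rintro c ⟨v, hv, rfl⟩
  rw [vecNorm_eq_norm] at hv ⊢
  rw [← Matrix.toEuclideanCLM_toLp (𝕜 := ℝ)]
  exact (ContinuousLinearMap.le_opNorm _ _).trans (mul_le_of_le_one_right (norm_nonneg _) hv)

theorem vecNorm_mulVec_le {N : ℕ} (A : Matrix (Fin N) (Fin N) ℝ) (v : Fin N → ℝ) :
    vecNorm (A.mulVec v) ≤ opNorm A * vecNorm v := by
  rcases (vecNorm_nonneg v).eq_or_lt with h | h
  · have hv : v = 0 := by
      have := h.symm
      rw [vecNorm_eq_norm, norm_eq_zero] at this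
      simpa using this
    simp [hv, vecNorm]
  · have key : vecNorm (A.mulVec ((vecNorm v)⁻¹ • v)) ≤ opNorm A := by
      refine le_csSup (bddAbove_opNorm A) ⟨_, ?_, rfl⟩
      rw [vecNorm_smul, abs_of_pos (inv_pos.2 h), inv_mul_cancel₀ h.ne']
    rw [Matrix.mulVec_smul, vecNorm_smul, abs_of_pos (inv_pos.2 h), inv_mul_le_iff₀ h] at key
    linarith

theorem opNorm_nonneg {N : ℕ} (A : Matrix (Fin N) (Fin N) ℝ) : 0 ≤ opNorm A := by
  refine Real.sSup_nonneg ?_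
  rintro c ⟨v, -, rfl⟩
  exact vecNorm_nonneg _

theorem vecNorm_pow_mulVec_le {N : ℕ} (A : Matrix (Fin N) (Fin N) ℝ) (n : ℕ) (v : Fin N → ℝ) :
    vecNorm ((A ^ n).mulVec v) ≤ opNorm A ^ n * vecNorm v := by
  induction n with
  | zero => simp
  | succ n ih =>
    rw [pow_succ', ← Matrix.mulVec_mulVec]
    calc _ ≤ opNorm A * vecNorm ((A ^ n).mulVec v) := vecNorm_mulVec_le _ _
      _ ≤ opNorm A * (opNorm A ^ n * vecNorm v) :=
        mul_le_mul_of_nonneg_left ih (opNorm_nonneg A)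
      _ = _ := by ring

theorem abs_pow_apply_le_opNorm_pow {N : ℕ} (A : Matrix (Fin N) (Fin N) ℝ) (n : ℕ)
    (x y : Fin N) : |(A ^ n) x y| ≤ opNorm A ^ n := by
  have h := abs_apply_le_vecNorm ((A ^ n).mulVec (Pi.single y 1)) x
  have h' := vecNorm_pow_mulVec_le A n (Pi.single y 1)
  have h1 : vecNorm (Pi.single y (1 : ℝ)) = 1 := by
    simp [vecNorm_eq_norm]
  rw [h1, mul_one] at h'
  simpa using h.trans h'

/-- Powers of a doubly stochastic symmetric matrix split off the projection onto constants. -/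
theorem sub_onesMat_pow {N : ℕ} (hN : N ≠ 0) {Q : Matrix (Fin N) (Fin N) ℝ} (hsym : Q.IsSymm)
    (hrow : ∀ i, ∑ j, Q i j = 1) {n : ℕ} (hn : n ≠ 0) :
    (Q - (N : ℝ)⁻¹ • onesMat N) ^ n = Q ^ n - (N : ℝ)⁻¹ • onesMat N := by
  have hcol : ∀ j, ∑ i, Q i j = 1 := fun j => by
    rw [← hrow j]
    exact Finset.sum_congr rfl fun i _ => hsym.apply j i
  have hN' : (N : ℝ) ≠ 0 := Nat.cast_ne_zero.2 hN
  set P := (N : ℝ)⁻¹ • onesMat N with hP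
  have hQP : Q * P = P := by
    ext i j
    simp [hP, onesMat, Matrix.mul_apply, ← Finset.sum_mul, hrow]
  have hPQ : P * Q = P := by
    ext i j
    simp [hP, onesMat, Matrix.mul_apply, ← Finset.mul_sum, hcol]
  have hPP : P * P = P := by
    ext i j
    simp [hP, onesMat, Matrix.mul_apply, hN']
  have hQnP : ∀ m : ℕ, Q ^ m * P = P := fun m => by
    induction m with
    | zero => simp
    | succ m ih => rw [pow_succ, mul_assoc, hQP, ih]
  induction n, Nat.one_le_iff_ne_zero.2 hn using Nat.le_induction with
  | base => simp
  | succ m hm ih =>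
    rw [pow_succ, ih (by lia), sub_mul, mul_sub, mul_sub, hQnP, hPQ, hPP, pow_succ]
    abel

theorem pow_apply_le {N : ℕ} (hN : N ≠ 0) {Q : Matrix (Fin N) (Fin N) ℝ} (hsym : Q.IsSymm)
    (hrow : ∀ i, ∑ j, Q i j = 1) {n : ℕ} (hn : n ≠ 0) (x y : Fin N) :
    (Q ^ n) x y ≤ opNorm (Q - (N : ℝ)⁻¹ • onesMat N) ^ n + (N : ℝ)⁻¹ := by
  have h := (le_abs_self _).trans
    (abs_pow_apply_le_opNorm_pow (Q - (N : ℝ)⁻¹ • onesMat N) n x y)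
  rw [sub_onesMat_pow hN hsym hrow hn] at h
  have h1 : onesMat N x y = 1 := rfl
  rw [Matrix.sub_apply, Matrix.smul_apply, h1, smul_eq_mul, mul_one] at h
  linarith

theorem pow_apply_nonneg {N : ℕ} {Q : Matrix (Fin N) (Fin N) ℝ} (hQ : ∀ i j, 0 ≤ Q i j)
    (n : ℕ) (x y : Fin N) : 0 ≤ (Q ^ n) x y := by
  induction n generalizing x y with
  | zero =>
    rw [pow_zero, Matrix.one_apply]
    positivity
  | succ n ih =>
    rw [pow_succ, Matrix.mul_apply]
    exact Finset.sum_nonneg fun i _ => mul_nonneg (ih x i) (hQ i y)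

theorem inv_natCast_le_pow {N d n : ℕ} (hN : 0 < N) (hd : 2 ≤ d) {ρ : ℝ}
    (hρ : (d : ℝ) ^ (-6 : ℤ) ≤ ρ) (hn : (n : ℝ) ≤ Real.log N / (6 * Real.log d)) :
    (N : ℝ)⁻¹ ≤ ρ ^ n := by
  have hd0 : (0 : ℝ) < d := by positivity
  have hN0 : (0 : ℝ) < N := by positivity
  have hlog : 0 < Real.log d := Real.log_pos (by exact_mod_cast hd)
  have hle : ((d : ℝ) ^ 6) ^ n ≤ N := by
    rw [← Real.log_le_log_iff (by positivity) hN0, Real.log_pow, Real.log_pow]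
    rw [le_div_iff₀ (by positivity)] at hn
    exact_mod_cast hn
  calc (N : ℝ)⁻¹ ≤ (((d : ℝ) ^ 6) ^ n)⁻¹ := inv_anti₀ (by positivity) hle
    _ = ((d : ℝ) ^ (-6 : ℤ)) ^ n := by
      rw [← inv_pow, zpow_neg]
      norm_cast
    _ ≤ ρ ^ n := by gcongr

theorem sum_range_weight_le (n : ℕ) :
    ∑ i ∈ Finset.range (n + 1), (if i = 0 then (1 : ℝ) else 2) * (1 / 2) ^ i ≤ 3 := by
  have h : ∑ i ∈ Finset.range (n + 1), (if i = 0 then (1 : ℝ) else 2) * (1 / 2) ^ i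
      = 3 - 2 * (1 / 2) ^ n := by
    induction n with
    | zero => norm_num
    | succ n ih =>
      rw [Finset.sum_range_succ, ih, if_neg n.succ_ne_zero]
      ring
  rw [h]
  have : (0 : ℝ) ≤ (1 / 2) ^ n := by positivity
  linarith

theorem sum_antidiagonalTuple_weight_le (k p : ℕ) :
    ∑ lam ∈ Finset.Nat.antidiagonalTuple k p, ∏ t, (if lam t = 0 then (1 : ℝ) else 2)
      ≤ 3 ^ k * 2 ^ p := by
  have hsub : Finset.Nat.antidiagonalTuple k p ⊆
      Fintype.piFinset fun _ : Fin k => Finset.range (p + 1) := fun lam hlam => by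
    rw [Finset.Nat.mem_antidiagonalTuple] at hlam
    rw [Fintype.mem_piFinset]
    intro t
    rw [Finset.mem_range, Nat.lt_succ_iff, ← hlam]
    exact Finset.single_le_sum (fun _ _ => Nat.zero_le _) (Finset.mem_univ t)
  have key : (∑ lam ∈ Finset.Nat.antidiagonalTuple k p,
      ∏ t, (if lam t = 0 then (1 : ℝ) else 2)) * (1 / 2) ^ p ≤ 3 ^ k :=
    calc _ = ∑ lam ∈ Finset.Nat.antidiagonalTuple k p,
          ∏ t, (if lam t = 0 then (1 : ℝ) else 2) * (1 / 2) ^ lam t := by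
          rw [Finset.sum_mul]
          refine Finset.sum_congr rfl fun lam hlam => ?_
          rw [Finset.Nat.mem_antidiagonalTuple] at hlam
          rw [Finset.prod_mul_distrib, Finset.prod_pow_eq_pow_sum, hlam]
      _ ≤ ∑ lam ∈ Fintype.piFinset fun _ : Fin k => Finset.range (p + 1),
          ∏ t, (if lam t = 0 then (1 : ℝ) else 2) * (1 / 2) ^ lam t :=
          Finset.sum_le_sum_of_subset_of_nonneg hsub fun lam _ _ => by positivity
      _ = ∏ _t : Fin k, ∑ i ∈ Finset.range (p + 1),
          (if i = 0 then (1 : ℝ) else 2) * (1 / 2) ^ i :=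
          (Finset.prod_univ_sum (fun _ : Fin k => Finset.range (p + 1))
            fun _ i => (if i = 0 then (1 : ℝ) else 2) * (1 / 2) ^ i).symm
      _ ≤ ∏ _t : Fin k, (3 : ℝ) :=
          Finset.prod_le_prod (fun _ _ => by positivity) fun _ _ => sum_range_weight_le p
      _ = 3 ^ k := by simp
  rwa [one_div, inv_pow, ← div_eq_mul_inv, div_le_iff₀ (by positivity)] at key

theorem sum_three_pow_mul_two_pow_le {p : ℕ} (hp : 1 ≤ p) :
    ∑ k ∈ Finset.Icc 1 p, (3 : ℝ) ^ k * 2 ^ p ≤ 8 ^ p := by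
  have h : ∑ k ∈ Finset.Icc 1 p, (3 : ℝ) ^ k = 3 / 2 * (3 ^ p - 1) := by
    clear hp
    induction p with
    | zero => simp
    | succ p ih =>
      rw [Finset.sum_Icc_succ_top (by lia), ih]
      ring
  rw [← Finset.sum_mul, h]
  have h4 : (3 : ℝ) / 2 * (3 ^ p - 1) ≤ 4 ^ p := by
    clear h
    induction p, hp using Nat.le_induction with
    | base => norm_num
    | succ p hp ih =>
      rw [pow_succ, pow_succ]
      have h1 : (3 : ℝ) ≤ 3 ^ p := le_self_pow₀ (by norm_num) (by lia)
      linarith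
  calc _ ≤ (4 : ℝ) ^ p * 2 ^ p := by gcongr
    _ = 8 ^ p := by rw [← mul_pow]; norm_num

/-- For `Q` symmetric, doubly stochastic, with `ρ := ‖Q − (1/N)·𝟙⊗𝟙‖` and
`d := ‖Q‖₀→₁`, assuming `d ≥ 2`, `ρ < 1` and `ρ ≥ d^{−6}`, one has for every `p ≥ 1` and all
`x, y`:
`Σ_{k=1}^{p} Σ_{λ₁+⋯+λ_k = p, λ_t ≤ ln N/(6 ln d)} ∏_{t=1}^{k} (Q^{λ_t})_{x,y} ≤ (8ρ)^p`. -/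
theorem stmt3 (N : ℕ) (hN : 2 ≤ N) (Q : Matrix (Fin N) (Fin N) ℝ) (hsym : Q.IsSymm)
    (hQ : ∀ i j, 0 ≤ Q i j) (hrow : ∀ i, ∑ j, Q i j = 1)
    (ρ : ℝ) (hρ : ρ = opNorm (Q - (N : ℝ)⁻¹ • onesMat N))
    (d : ℕ) (hd : d = zeroOneNorm Q) (hd2 : 2 ≤ d)
    (hρ1 : ρ < 1) (hρd : (d : ℝ) ^ (-6 : ℤ) ≤ ρ)
    (p : ℕ) (hp : 1 ≤ p) (x y : Fin N) :
    ∑ k ∈ Finset.Icc 1 p,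
        ∑ lam ∈ (Finset.Nat.antidiagonalTuple k p).filter
            (fun lam => ∀ t, (lam t : ℝ) ≤ Real.log N / (6 * Real.log d)),
          ∏ t, (Q ^ lam t) x y ≤ (8 * ρ) ^ p := by
  have hN0 : N ≠ 0 := by lia
  have hρ0 : 0 ≤ ρ := hρ ▸ opNorm_nonneg _
  have hentry : ∀ n : ℕ, (n : ℝ) ≤ Real.log N / (6 * Real.log d) →
      (Q ^ n) x y ≤ (if n = 0 then (1 : ℝ) else 2) * ρ ^ n := by
    intro n hn
    split_ifs with h0
    · subst h0
      rw [pow_zero, pow_zero, Matrix.one_apply]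
      split_ifs <;> norm_num
    · have h1 := pow_apply_le hN0 hsym hrow h0 x y
      rw [← hρ] at h1
      have h2 := inv_natCast_le_pow (by lia) hd2 hρd hn
      linarith
  calc _ ≤ ∑ k ∈ Finset.Icc 1 p, (3 ^ k * 2 ^ p) * ρ ^ p := by
        refine Finset.sum_le_sum fun k _ => ?_
        calc _ ≤ ∑ lam ∈ (Finset.Nat.antidiagonalTuple k p).filter
                (fun lam => ∀ t, (lam t : ℝ) ≤ Real.log N / (6 * Real.log d)),
                (∏ t, (if lam t = 0 then (1 : ℝ) else 2)) * ρ ^ p := by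
              refine Finset.sum_le_sum fun lam hlam => ?_
              rw [Finset.mem_filter, Finset.Nat.mem_antidiagonalTuple] at hlam
              rw [← hlam.1, ← Finset.prod_pow_eq_pow_sum, ← Finset.prod_mul_distrib]
              exact Finset.prod_le_prod (fun t _ => pow_apply_nonneg hQ _ x y)
                fun t _ => hentry _ (hlam.2 t)
          _ ≤ ∑ lam ∈ Finset.Nat.antidiagonalTuple k p,
                (∏ t, (if lam t = 0 then (1 : ℝ) else 2)) * ρ ^ p :=
              Finset.sum_le_sum_of_subset_of_nonneg (Finset.filter_subset _ _)
                fun lam _ _ => by positivity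
          _ ≤ (3 ^ k * 2 ^ p) * ρ ^ p := by
              rw [← Finset.sum_mul]
              exact mul_le_mul_of_nonneg_right (sum_antidiagonalTuple_weight_le k p)
                (by positivity)
    _ ≤ 8 ^ p * ρ ^ p := by
        rw [← Finset.sum_mul]
        exact mul_le_mul_of_nonneg_right (sum_three_pow_mul_two_pow_le hp) (by positivity)
    _ = (8 * ρ) ^ p := (mul_pow _ _ _).symm
end
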